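/- Let k ≥ 2 be an even integer. Then the limit ν(k) := lim_{d→∞} (log₂ K(d,k))/d exists, and equals the supremum over n ≥ (k+2)² + 3 of log₂(K(n−3,k)/k)/n. -/

import Mathlib

/-- Cyclic distance between two indices on a cycle of length `N`. -/
def cycDist {N : ℕ} (i j : ZMod N) : ℕ := min (j - i).val (i - j).val

/-- A `(d,k)` circuit code of length `N`: a simple cycle `x₁,…,x_N` in the
`d`-dimensional hypercube graph `I(d)` (vertices are binary vectors of length
`d`, adjacency is Hamming distance `1`, and the graph distance in `I(d)` equals
the Hamming distance) such that for any two vertices of the cycle the graph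
distance is at least the minimum of their distance along the cycle and `k`. -/
def IsCircuitCode (d k N : ℕ) (x : ZMod N → (Fin d → Bool)) : Prop :=
  3 ≤ N ∧ Function.Injective x ∧
    (∀ i : ZMod N, hammingDist (x i) (x (i + 1)) = 1) ∧
    (∀ i j : ZMod N, min (cycDist i j) k ≤ hammingDist (x i) (x j))

/-- `K d k`: the maximum length of a `(d,k)` circuit code. -/
noncomputable def K (d k : ℕ) : ℕ :=
  sSup {N | ∃ x : ZMod N → (Fin d → Bool), IsCircuitCode d k N x}

/-- A closed walk indexed by `0, …, L` whose steps have Hamming length one and which satisfies the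
spread condition induces a circuit code of length `L`. -/
theorem IsCircuitCode.of_nat {d k L : ℕ} (hk : 1 ≤ k) (hL : 3 ≤ L) (f : ℕ → Fin d → Bool)
    (hclosed : f L = f 0) (hstep : ∀ t < L, hammingDist (f t) (f (t + 1)) = 1)
    (hspread : ∀ s t, s ≤ t → t < L →
      min (min (t - s) (L - (t - s))) k ≤ hammingDist (f s) (f t)) :
    IsCircuitCode d k L (fun i => f i.val) := by
  have : NeZero L := ⟨by omega⟩
  have : Fact (1 < L) := ⟨by omega⟩
  have key : ∀ i j : ZMod L, i.val ≤ j.val →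
      cycDist i j ≤ min (j.val - i.val) (L - (j.val - i.val)) := by
    intro i j hij
    have h1 : (j - i).val = j.val - i.val := ZMod.val_sub hij
    have h2 : (i - j).val ≤ L - (j.val - i.val) := by
      rw [← neg_sub j i, ZMod.neg_val, h1]
      split_ifs <;> omega
    unfold cycDist
    rw [h1]
    omega
  have spread : ∀ i j : ZMod L, min (cycDist i j) k ≤ hammingDist (f i.val) (f j.val) := by
    intro i j
    rcases le_total i.val j.val with h | h
    · have := key i j h
      have := hspread _ _ h j.val_lt
      omega
    · have := key j i h
      have := hspread _ _ h i.val_lt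
      have hc : cycDist i j = cycDist j i := min_comm _ _
      rw [hammingDist_comm]
      omega
  refine ⟨hL, ?_, ?_, spread⟩
  · intro i j hij
    by_contra hne
    have h := spread i j
    simp only at hij
    rw [hij, hammingDist_self] at h
    have h1 : (j - i).val ≠ 0 := by
      rw [Ne, ZMod.val_eq_zero, sub_eq_zero]; exact fun h => hne h.symm
    have h2 : (i - j).val ≠ 0 := by
      rw [Ne, ZMod.val_eq_zero, sub_eq_zero]; exact hne
    unfold cycDist at h
    omega
  · intro i
    have hi := hstep i.val i.val_lt
    have hv : (i + 1).val = (i.val + 1) % L := by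
      rw [ZMod.val_add, ZMod.val_one]
    show hammingDist (f i.val) (f (i + 1).val) = 1
    rcases (Nat.succ_le_of_lt i.val_lt).lt_or_eq with h | h
    · rwa [hv, Nat.mod_eq_of_lt h]
    · have h' : i.val + 1 = L := h
      rw [hv, h', Nat.mod_self, ← hclosed]
      rwa [h'] at hi

theorem IsCircuitCode.spread_add {d k N : ℕ} {x : ZMod N → Fin d → Bool}
    (hx : IsCircuitCode d k N x) (a : ZMod N) {c : ℕ} (hc : c ≤ N) :
    min (min c (N - c)) k ≤ hammingDist (x a) (x (a + c)) := by
  have hN := hx.1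
  have : NeZero N := ⟨by omega⟩
  rcases hc.lt_or_eq with h | rfl
  · refine le_trans ?_ (hx.2.2.2 a (a + c))
    unfold cycDist
    have h1 : (a + c - a).val = c := by
      rw [add_sub_cancel_left, ZMod.val_natCast, Nat.mod_eq_of_lt h]
    have h2 : c = 0 ∨ (a - (a + c)).val = N - c := by
      have : a - (a + c) = -(c : ZMod N) := by ring
      rw [this, ZMod.neg_val, ZMod.val_natCast, Nat.mod_eq_of_lt h]
      split_ifs with h0
      · left
        rw [← ZMod.val_eq_zero, ZMod.val_natCast, Nat.mod_eq_of_lt h] at h0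
        exact h0
      · right; rfl
    rw [h1]
    omega
  · simp

theorem hammingDist_append {m n : ℕ} (a a' : Fin m → Bool) (b b' : Fin n → Bool) :
    hammingDist (Fin.append a b) (Fin.append a' b') = hammingDist a a' + hammingDist b b' := by
  simp only [hammingDist, Finset.card_filter, Fin.sum_univ_add, Fin.append_left, Fin.append_right]

theorem IsCircuitCode.append_const {d k N : ℕ} {x : ZMod N → Fin d → Bool}
    (hx : IsCircuitCode d k N x) (e : ℕ) :
    IsCircuitCode (d + e) k N (fun i => Fin.append (x i) (fun _ : Fin e => false)) := by
  obtain ⟨h1, h2, h3, h4⟩ := hx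
  refine ⟨h1, fun i j hij => ?_, fun i => ?_, fun i j => ?_⟩
  · have := congrArg (fun v => hammingDist v (Fin.append (x j) (fun _ : Fin e => false))) hij
    simp only [hammingDist_append, hammingDist_self, add_zero] at this
    exact h2 (hammingDist_eq_zero.1 this)
  · simpa [hammingDist_append] using h3 i
  · simpa [hammingDist_append] using h4 i j

theorem IsCircuitCode.le_two_pow {d k N : ℕ} {x : ZMod N → Fin d → Bool}
    (hx : IsCircuitCode d k N x) : N ≤ 2 ^ d := by
  have hN := hx.1
  have : NeZero N := ⟨by omega⟩
  simpa [ZMod.card] using Fintype.card_le_of_injective x hx.2.1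

theorem IsCircuitCode.le_K {d k N : ℕ} {x : ZMod N → Fin d → Bool}
    (hx : IsCircuitCode d k N x) : N ≤ K d k :=
  le_csSup ⟨2 ^ d, fun _ ⟨_, hy⟩ => hy.le_two_pow⟩ ⟨x, hx⟩

theorem K_le_two_pow (d k : ℕ) : K d k ≤ 2 ^ d :=
  csSup_le' fun _ ⟨_, hy⟩ => hy.le_two_pow

theorem exists_isCircuitCode_K {d k : ℕ} (h : 0 < K d k) :
    ∃ x : ZMod (K d k) → Fin d → Bool, IsCircuitCode d k (K d k) x := by
  refine Nat.sSup_mem (s := {N | ∃ x : ZMod N → (Fin d → Bool), IsCircuitCode d k N x})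
    (Set.nonempty_iff_ne_empty.2 fun he => ?_) ⟨2 ^ d, fun _ ⟨_, hy⟩ => hy.le_two_pow⟩
  simp [K, he] at h

theorem K_mono (k : ℕ) : Monotone (fun d => K d k) := by
  intro d d' hdd
  obtain ⟨e, rfl⟩ := Nat.exists_eq_add_of_le hdd
  rcases Nat.eq_zero_or_pos (K d k) with h | h
  · simp [h]
  · obtain ⟨x, hx⟩ := exists_isCircuitCode_K h
    exact (hx.append_const e).le_K

theorem two_mul_le_K {d k : ℕ} (hd : 2 ≤ d) (hk : 1 ≤ k) : 2 * d ≤ K d k := by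
  set f : ℕ → Fin d → Bool := fun n j => decide ((n + j.val) / d % 2 = 1) with hf
  have hstep : ∀ t, hammingDist (f t) (f (t + 1)) = 1 := by
    intro t
    unfold hammingDist
    rw [Finset.card_eq_one]
    have hlt : d - 1 - t % d < d := by omega
    refine ⟨⟨d - 1 - t % d, hlt⟩, ?_⟩
    ext j
    simp only [hf, Finset.mem_filter, Finset.mem_univ, true_and, Finset.mem_singleton, Fin.ext_iff,
      ne_eq, decide_eq_decide]
    have hmod : t % d < d := Nat.mod_lt _ (by omega)
    have hj := j.isLt
    have e1 : t + 1 + j.val = (t % d + j.val + 1) + d * (t / d) := by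
      have := Nat.mod_add_div t d; omega
    have e2 : t + j.val = (t % d + j.val) + d * (t / d) := by
      have := Nat.mod_add_div t d; omega
    rw [e1, e2, Nat.add_mul_div_left _ _ (by omega), Nat.add_mul_div_left _ _ (by omega)]
    have small : ∀ u, u < d → u / d = 0 := fun u hu => Nat.div_eq_of_lt hu
    have large : ∀ u, d ≤ u → u < 2 * d → u / d = 1 := fun u h1 h2 =>
      Nat.div_eq_of_lt_le (by omega) (by omega)
    rcases lt_trichotomy (t % d + j.val + 1) d with h | h | h
    · rw [small _ h, small _ (by omega)]; omega
    · rw [large _ h.ge (by omega), small _ (by omega)]; omega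
    · rw [large _ h.le (by omega), large _ (by omega) (by omega)]; omega
  have hanti : ∀ t, hammingDist (f t) (f (t + d)) = d := by
    intro t
    have : ∀ j : Fin d, f t j ≠ f (t + d) j := by
      intro j
      simp only [hf, ne_eq, decide_eq_decide]
      rw [show t + d + j.val = t + j.val + d by ring, Nat.add_div_right _ (by omega)]
      omega
    unfold hammingDist
    rw [Finset.filter_true_of_mem (fun j _ => this j)]
    simp
  have hper : ∀ t, f (t + 2 * d) = f t := by
    intro t
    funext j
    simp only [hf, decide_eq_decide]
    rw [show t + 2 * d + j.val = t + j.val + d * 2 by ring, Nat.add_mul_div_left _ _ (by omega)]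
    omega
  have hle : ∀ t s, hammingDist (f t) (f (t + s)) ≤ s := by
    intro t s
    induction s with
    | zero => simp
    | succ s ih =>
      have := hammingDist_triangle (f t) (f (t + s)) (f (t + s + 1))
      have := hstep (t + s)
      rw [show t + (s + 1) = t + s + 1 by ring]
      omega
  have hge : ∀ t s, s ≤ d → s ≤ hammingDist (f t) (f (t + s)) := by
    intro t s hs
    have h1 := hammingDist_triangle (f t) (f (t + s)) (f (t + d))
    have h2 := hle (t + s) (d - s)
    rw [show t + s + (d - s) = t + d by omega] at h2
    have := hanti t
    omega
  refine (IsCircuitCode.of_nat hk (by omega) f (by simpa using hper 0) (fun t _ => hstep t) ?_).le_K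
  intro s t hst ht
  rcases le_total (t - s) d with h | h
  · have := hge s (t - s) h
    rw [show s + (t - s) = t by omega] at this
    omega
  · have := hge t (2 * d - (t - s)) (by omega)
    rw [show t + (2 * d - (t - s)) = s + 2 * d by omega, hper, hammingDist_comm] at this
    omega

/-- First coordinate of the staircase made of `J` blocks (`m` vertical steps, then `k` horizontal
steps) followed by horizontal steps only. -/
def stairX (m k J t : ℕ) : ℕ :=
  if t < J * (m + k) then t / (m + k) * k + (t % (m + k) - m) else J * k + (t - J * (m + k))

/-- Second coordinate of the staircase of `stairX`. -/
def stairY (m k J t : ℕ) : ℕ :=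
  if t < J * (m + k) then t / (m + k) * m + min (t % (m + k)) m else J * m

theorem stair_cases {m k : ℕ} (hk : 1 ≤ k) (J t : ℕ) :
    (∃ j s, j < J ∧ s < m + k ∧ t = j * m + j * k + s ∧
      stairX m k J t = j * k + (s - m) ∧ stairY m k J t = j * m + min s m) ∨
    (∃ s, t = J * m + J * k + s ∧ stairX m k J t = J * k + s ∧ stairY m k J t = J * m) := by
  unfold stairX stairY
  split_ifs with h
  · refine Or.inl ⟨t / (m + k), t % (m + k), ?_, Nat.mod_lt _ (by omega), ?_, rfl, rfl⟩
    · exact (Nat.div_lt_iff_lt_mul (by omega)).2 h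
    · rw [← mul_add, Nat.div_add_mod']
  · refine Or.inr ⟨t - J * (m + k), ?_, rfl, rfl⟩
    rw [← mul_add]; omega

theorem stair_add {m k : ℕ} (hk : 1 ≤ k) (J t : ℕ) :
    stairX m k J t + stairY m k J t = t := by
  rcases stair_cases (m := m) hk J t with ⟨j, s, -, -, h1, h2, h3⟩ | ⟨s, h1, h2, h3⟩ <;> omega

theorem stair_monotone {m k : ℕ} (hk : 1 ≤ k) (J : ℕ) {s t : ℕ} (hst : s ≤ t) :
    stairX m k J s ≤ stairX m k J t ∧ stairY m k J s ≤ stairY m k J t ∧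
    (stairX m k J t < stairX m k J s + k → stairY m k J t ≤ stairY m k J s + m) := by
  have expand : ∀ i j : ℕ, i + 1 ≤ j → i * k + k ≤ j * k ∧ i * m + m ≤ j * m := fun i j h =>
    ⟨by nlinarith, by nlinarith⟩
  have expand2 : ∀ i j : ℕ, i + 2 ≤ j → i * k + 2 * k ≤ j * k := fun i j h => by nlinarith
  rcases stair_cases (m := m) hk J s with ⟨i, u, hi, hu, h1, h2, h3⟩ | ⟨u, h1, h2, h3⟩ <;>
  rcases stair_cases (m := m) hk J t with ⟨j, v, hj, hv, h4, h5, h6⟩ | ⟨v, h4, h5, h6⟩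
  · rw [h2, h3, h5, h6]
    rcases lt_trichotomy j i with h | rfl | h
    · have := expand j i h; omega
    · omega
    · have e := expand i j h
      refine ⟨by omega, by omega, fun hlt => ?_⟩
      rcases (Nat.succ_le_of_lt h).lt_or_eq with h' | rfl
      · have := expand2 i j h'; omega
      · have : (i + 1) * m = i * m + m := by ring
        have : (i + 1) * k = i * k + k := by ring
        simp only [Nat.succ_eq_add_one] at *
        omega
  · rw [h2, h3, h5, h6]
    have e := expand i J hi
    refine ⟨by omega, by omega, fun hlt => ?_⟩
    rcases (Nat.succ_le_of_lt hi).lt_or_eq with h' | rfl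
    · have := expand2 i J h'; omega
    · have : (i + 1) * m = i * m + m := by ring
      have : (i + 1) * k = i * k + k := by ring
      simp only [Nat.succ_eq_add_one] at *
      omega
  · have := expand j J hj; omega
  · omega

/-- The product construction: winding around the second code once for every `k` steps along the
first one. -/
theorem IsCircuitCode.exists_product {d₁ d₂ k N₁ N₂ J : ℕ} (hk : 1 ≤ k)
    {x : ZMod N₁ → Fin d₁ → Bool} {y : ZMod N₂ → Fin d₂ → Bool}
    (hx : IsCircuitCode d₁ k N₁ x) (hy : IsCircuitCode d₂ k N₂ y) (hN₂ : k ≤ N₂)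
    (hN₁ : 2 * k ≤ N₁) (hJN₁ : J * k + k ≤ N₁) (hJ : N₂ ∣ J) :
    ∃ z, IsCircuitCode (d₁ + d₂) k (J * N₂ + (N₁ - J * k)) z := by
  obtain ⟨m, rfl⟩ : ∃ m, N₂ = m + k := ⟨N₂ - k, by omega⟩
  set L := J * (m + k) + (N₁ - J * k) with hL
  have hLm : L = J * m + N₁ := by rw [hL, mul_add]; omega
  set X := stairX m k J with hX
  set Y := stairY m k J with hY
  have hadd : ∀ t, X t + Y t = t := stair_add hk J
  have hmono : ∀ s t, s ≤ t → X s ≤ X t ∧ Y s ≤ Y t ∧ (X t < X s + k → Y t ≤ Y s + m) :=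
    fun s t => stair_monotone hk J
  have hXL : X L = N₁ := by
    simp only [hX, stairX, hL]
    rw [if_neg (by omega)]; omega
  have hYL : Y L = J * m := by
    have := hadd L; omega
  have hYlate : ∀ t, J * k < X t → Y t = J * m := by
    intro t ht
    rcases stair_cases (m := m) hk J t with ⟨j, s, hj, hs, h1, h2, h3⟩ | ⟨s, h1, h2, h3⟩
    · have : j * k + k ≤ J * k := by nlinarith
      have h2' : X t = _ := h2
      omega
    · exact h3
  have hX0 : X 0 = 0 := by have := hadd 0; omega
  have hY0 : Y 0 = 0 := by have := hadd 0; omega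
  have hYearly : ∀ t, X t < k → Y t ≤ m := by
    intro t ht
    have := (hmono 0 t (Nat.zero_le _)).2.2
    omega
  have hJm : ((J * m : ℕ) : ZMod (m + k)) = 0 := by
    rw [ZMod.natCast_eq_zero_iff]; exact hJ.mul_right m
  refine ⟨_, IsCircuitCode.of_nat hk (L := L) (by have := hx.1; omega)
    (fun t => Fin.append (x (X t)) (y (Y t))) ?_ ?_ ?_⟩
  · simp only [hXL, hYL, hX0, hY0, hJm, ZMod.natCast_self, Nat.cast_zero]
  · intro t _
    rw [hammingDist_append]
    have h := hmono t (t + 1) (by omega)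
    have h1 := hadd t
    have h2 := hadd (t + 1)
    have : (X (t + 1) = X t + 1 ∧ Y (t + 1) = Y t) ∨ (X (t + 1) = X t ∧ Y (t + 1) = Y t + 1) := by
      omega
    rcases this with ⟨ha, hb⟩ | ⟨ha, hb⟩
    · rw [ha, hb, hammingDist_self, Nat.cast_succ, hx.2.2.1]
    · rw [ha, hb, hammingDist_self, Nat.cast_succ, hy.2.2.1]
  · intro s t hst ht
    rw [hammingDist_append]
    obtain ⟨hXle, hYle, hclose⟩ := hmono s t hst
    have hs1 := hadd s
    have ht1 := hadd t
    have hXt : X t ≤ N₁ := hXL ▸ (hmono t L ht.le).1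
    have hdx := hx.spread_add (X s : ZMod N₁) (c := X t - X s) (by omega)
    rw [← Nat.cast_add, Nat.add_sub_cancel' hXle] at hdx
    by_cases h1 : X t < X s + k
    · have hb := hclose h1
      have hdy := hy.spread_add (Y s : ZMod (m + k)) (c := Y t - Y s) (by omega)
      rw [← Nat.cast_add, Nat.add_sub_cancel' hYle] at hdy
      omega
    · by_cases h2 : N₁ < X t - X s + k
      · have hYt := hYlate t (by omega)
        have hYs := hYearly s (by omega)
        have hdy := hy.spread_add 0 (c := Y s) (by omega)
        rw [zero_add, hammingDist_comm] at hdy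
        rw [hYt, hJm]
        omega
      · omega

theorem mul_sub_le_K_add {k D d : ℕ} (hk : 1 ≤ k) (hD : k < K D k) (hd : 2 * k ≤ K d k) :
    ((K D k : ℝ) / k) * (K d k - (k + k * K D k)) ≤ K (d + D) k := by
  obtain ⟨x, hx⟩ := exists_isCircuitCode_K (d := d) (k := k) (by omega)
  obtain ⟨y, hy⟩ := exists_isCircuitCode_K (d := D) (k := k) (by omega)
  generalize K d k = N₁ at *
  generalize K D k = N₂ at *
  have hpos : 0 < k * N₂ := Nat.mul_pos hk (by omega)
  set q := (N₁ - k) / (k * N₂) with hq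
  have h1 : q * (k * N₂) ≤ N₁ - k := Nat.div_mul_le_self _ _
  have h2 : N₁ - k < (q + 1) * (k * N₂) :=
    (Nat.div_lt_iff_lt_mul hpos).1 (Nat.lt_succ_self _)
  have e : N₂ * q * k = q * (k * N₂) := by ring
  obtain ⟨z, hz⟩ := hx.exists_product hk hy hD.le hd (J := N₂ * q) (by omega) (dvd_mul_right _ _)
  have h3 : N₂ * q * N₂ ≤ K (d + D) k := by have := hz.le_K; omega
  have h4 : (N₁ : ℝ) - (k + k * N₂) ≤ k * (N₂ * q) := by
    have : N₁ ≤ k * (N₂ * q) + (k + k * N₂) := by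
      nlinarith [Nat.sub_add_cancel (show k ≤ N₁ by omega)]
    have : (N₁ : ℝ) ≤ k * (N₂ * q) + (k + k * N₂) := by exact_mod_cast this
    linarith
  have hk0 : (0 : ℝ) < k := by exact_mod_cast hk
  calc (N₂ : ℝ) / k * (N₁ - (k + k * N₂)) ≤ N₂ / k * (k * (N₂ * q)) := by gcongr
    _ = ((N₂ * q * N₂ : ℕ) : ℝ) := by push_cast; field_simp
    _ ≤ _ := by exact_mod_cast h3

theorem exists_pow_le_K {k D : ℕ} (hk : 1 ≤ k) (hD : k < K D k) :
    ∃ d₀ : ℕ, ∀ t : ℕ, ((K D k : ℝ) / k) ^ t ≤ K (d₀ + t * D) k := by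
  have hk0 : (0 : ℝ) < k := by exact_mod_cast hk
  set ρ : ℝ := (K D k : ℝ) / k with hρ
  have hρ1 : 1 < ρ := by
    rw [hρ, one_lt_div hk0]; exact_mod_cast hD
  set A : ℝ := k + k * K D k with hA
  have hA0 : 0 ≤ A := by positivity
  set c : ℝ := ρ * A / (ρ - 1) with hc
  have hc0 : 0 ≤ c := div_nonneg (by positivity) (by linarith)
  have hfix : ρ * (c - A) = c := by
    have : ρ - 1 ≠ 0 := by linarith
    rw [hc]; field_simp; ring
  obtain ⟨M, hM⟩ := exists_nat_ge (c + 1)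
  refine ⟨M + k + 2, fun t => ?_⟩
  have hbase : 2 * (M + k + 2) ≤ K (M + k + 2) k := two_mul_le_K (by omega) hk
  have key : ∀ t : ℕ, c + ρ ^ t ≤ K (M + k + 2 + t * D) k := by
    intro t
    induction t with
    | zero =>
      have : ((2 * (M + k + 2) : ℕ) : ℝ) ≤ K (M + k + 2) k := by exact_mod_cast hbase
      push_cast at this
      simp only [pow_zero, zero_mul, add_zero]
      linarith
    | succ t ih =>
      have hmono : K (M + k + 2) k ≤ K (M + k + 2 + t * D) k := K_mono k (by omega)
      have hstep := mul_sub_le_K_add hk hD (d := M + k + 2 + t * D) (by omega)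
      rw [show M + k + 2 + (t + 1) * D = M + k + 2 + t * D + D by ring]
      refine le_trans ?_ hstep
      calc c + ρ ^ (t + 1) = ρ * (c + ρ ^ t - A) := by rw [pow_succ]; linear_combination -hfix
        _ ≤ _ := by gcongr
  linarith [key t]

open Filter Topology in
/-- The growth rate of `K d k` is at least `log₂ (K D k / k) / D`. -/
theorem eventually_lt_logb_K {k D : ℕ} (hk : 1 ≤ k) (hD : k < K D k) {a : ℝ}
    (ha : a < Real.logb 2 ((K D k : ℝ) / k) / D) :
    ∀ᶠ d : ℕ in atTop, a < Real.logb 2 (K d k) / d := by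
  have hD0 : 0 < D := by
    rcases Nat.eq_zero_or_pos D with rfl | h
    · have := K_le_two_pow 0 k; omega
    · exact h
  have hDR : (0 : ℝ) < D := by exact_mod_cast hD0
  have hk0 : (0 : ℝ) < k := by exact_mod_cast hk
  obtain ⟨d₀, hd₀⟩ := exists_pow_le_K hk hD
  set ρ : ℝ := (K D k : ℝ) / k with hρ
  have hρ1 : 1 < ρ := by
    rw [hρ, one_lt_div hk0]; exact_mod_cast hD
  set l := Real.logb 2 ρ with hl
  have hl0 : 0 ≤ l := Real.logb_nonneg (by norm_num) hρ1.le
  have hlim : Tendsto (fun d : ℕ => l / D - ((d₀ + D) / D * l) / (d : ℝ)) atTop (𝓝 (l / D)) := by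
    simpa using tendsto_const_nhds.sub
      (tendsto_const_nhds.div_atTop (tendsto_natCast_atTop_atTop (R := ℝ)))
  filter_upwards [hlim.eventually_const_lt ha, eventually_ge_atTop (d₀ + 1)] with d h1 h2
  refine h1.trans_le ?_
  have hd0 : (0 : ℝ) < d := by exact_mod_cast (by omega : 0 < d)
  set t := (d - d₀) / D with ht
  have ht1 : t * D ≤ d - d₀ := Nat.div_mul_le_self _ _
  have ht2 : d - d₀ < (t + 1) * D := (Nat.div_lt_iff_lt_mul hD0).1 (Nat.lt_succ_self _)
  have ht3 : (d : ℝ) ≤ (t + 1) * D + d₀ := by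
    exact_mod_cast (by omega : d ≤ (t + 1) * D + d₀)
  have h3 : ρ ^ t ≤ K d k :=
    (hd₀ t).trans (by exact_mod_cast K_mono k (by omega : d₀ + t * D ≤ d))
  have h4 : t * l ≤ Real.logb 2 (K d k) := by
    rw [hl, ← Real.logb_pow]
    exact Real.logb_le_logb_of_le (by norm_num) (by positivity) h3
  rw [le_div_iff₀ hd0]
  refine le_trans ?_ h4
  have e : (l / D - ((d₀ + D) / D * l) / (d : ℝ)) * d = (d - d₀ - D) / D * l := by
    field_simp; ring
  rw [e]
  refine mul_le_mul_of_nonneg_right ?_ hl0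
  rw [div_le_iff₀ hDR]
  linarith

/-- For even `k ≥ 2`, the limit `ν(k) = lim_{d→∞} (log₂ K(d,k))/d` exists and
equals `sup_{n ≥ (k+2)²+3} log₂(K(n−3,k)/k)/n`. -/
theorem stmt_7 (k : ℕ) (hk : 2 ≤ k) (hke : Even k) :
    Filter.Tendsto (fun d : ℕ => Real.logb 2 (K d k) / d) Filter.atTop
      (nhds (sSup {x : ℝ | ∃ n : ℕ, (k + 2) ^ 2 + 3 ≤ n ∧
        x = Real.logb 2 ((K (n - 3) k : ℝ) / k) / n})) := by
  set S := {x : ℝ | ∃ n : ℕ, (k + 2) ^ 2 + 3 ≤ n ∧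
    x = Real.logb 2 ((K (n - 3) k : ℝ) / k) / n} with hS
  have hk0 : (0 : ℝ) < k := by exact_mod_cast (by omega : 0 < k)
  have hk1 : (1 : ℝ) ≤ k := by exact_mod_cast (by omega : 1 ≤ k)
  have hKpos : ∀ d, 2 ≤ d → (0 : ℝ) < K d k := fun d hd => by
    have := two_mul_le_K hd (by omega : 1 ≤ k)
    exact_mod_cast (by omega : 0 < K d k)
  have hne : S.Nonempty := ⟨_, (k + 2) ^ 2 + 3, le_rfl, rfl⟩
  have hbdd : BddAbove S := by
    refine ⟨1, ?_⟩
    rintro x ⟨n, hn, rfl⟩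
    have hn16 : 16 ≤ (k + 2) ^ 2 := by nlinarith
    have hn0 : (0 : ℝ) < n := by exact_mod_cast (by omega : 0 < n)
    have hK := hKpos (n - 3) (by omega)
    rw [div_le_one hn0, Real.logb_le_iff_le_rpow (by norm_num) (by positivity), Real.rpow_natCast]
    have h1 : (K (n - 3) k : ℝ) ≤ 2 ^ (n - 3) := by exact_mod_cast K_le_two_pow (n - 3) k
    have h2 : (2 : ℝ) ^ (n - 3) ≤ 2 ^ n := pow_le_pow_right₀ (by norm_num) (by omega)
    exact (div_le_self hK.le hk1).trans (h1.trans h2)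
  refine tendsto_order.2 ⟨fun a ha => ?_, fun a ha => ?_⟩
  · obtain ⟨_, ⟨n, hn, rfl⟩, hx⟩ := exists_lt_of_lt_csSup hne ha
    have hn16 : 16 ≤ (k + 2) ^ 2 := by nlinarith
    have hn0 : (0 : ℝ) < ((n - 3 : ℕ) : ℝ) := by exact_mod_cast (by omega : 0 < n - 3)
    by_cases hD : k < K (n - 3) k
    · refine eventually_lt_logb_K (by omega) hD (hx.trans_le ?_)
      have h1 : 1 ≤ (K (n - 3) k : ℝ) / k := by
        rw [one_le_div hk0]; exact_mod_cast hD.le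
      refine div_le_div_of_nonneg_left (Real.logb_nonneg (by norm_num) h1) hn0 ?_
      exact_mod_cast Nat.sub_le n 3
    · have h1 : (K (n - 3) k : ℝ) / k ≤ 1 := by
        rw [div_le_one hk0]; exact_mod_cast not_lt.1 hD
      have h2 : Real.logb 2 ((K (n - 3) k : ℝ) / k) / n ≤ 0 :=
        div_nonpos_of_nonpos_of_nonneg
          (Real.logb_nonpos (by norm_num) (by positivity) h1) (Nat.cast_nonneg n)
      filter_upwards [Filter.eventually_ge_atTop 2] with d hd
      have h3 : (1 : ℝ) ≤ K d k := by exact_mod_cast hKpos d hd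
      exact (hx.trans_le h2).trans_le
        (div_nonneg (Real.logb_nonneg (by norm_num) h3) (Nat.cast_nonneg d))
  · have hlim : Filter.Tendsto (fun d : ℕ => sSup S + (3 * sSup S + Real.logb 2 k) / (d : ℝ))
        Filter.atTop (nhds (sSup S)) := by
      simpa using tendsto_const_nhds.add
        (tendsto_const_nhds.div_atTop (tendsto_natCast_atTop_atTop (R := ℝ)))
    filter_upwards [hlim.eventually_lt_const ha,
      Filter.eventually_ge_atTop ((k + 2) ^ 2)] with d h1 h2
    refine lt_of_le_of_lt ?_ h1
    have hd16 : 16 ≤ (k + 2) ^ 2 := by nlinarith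
    have hd0 : (0 : ℝ) < d := by exact_mod_cast (by omega : 0 < d)
    have hle : Real.logb 2 ((K d k : ℝ) / k) / (d + 3 : ℕ) ≤ sSup S :=
      le_csSup hbdd ⟨d + 3, by omega, rfl⟩
    rw [div_le_iff₀ (by positivity), Real.logb_div (hKpos d (by omega)).ne' hk0.ne'] at hle
    push_cast at hle
    rw [div_le_iff₀ hd0, add_mul, div_mul_cancel₀ _ hd0.ne']
    linarith
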